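/- arXiv:2303.12372 — 6 statements merged into one kernel-verified Lean document; each statement's English description precedes it below -/
import Mathlib

section
/- Define on [0,1) the functions E(t) = (eᵗ + 1)/2, E_l(t) = 1/(2(1 − t)), E_r(t) = 0, and the flux functions v_l(t) = −1 + t, v_r(t) = 1. Then E, E_l, E_r are nonnegative and differentiable on [0,1), for every t ∈ [0,1) one has the Gronwall-type inequality E'(t) + (1/2)E_l(t)|v_l(t)| + (1/2)E_r(t)|v_r(t)| ≤ E(t), and yet E_l(t) → +∞ as t → 1⁻. -/
open Set Filter

/-- **Blow-up example for the Gronwall system (Remark 2.9).**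
With `E(t) = (eᵗ+1)/2`, `E_l(t) = 1/(2(1−t))`, `E_r(t) = 0`, `v_l(t) = −1+t`, `v_r(t) = 1`:
`E, E_l, E_r` are nonnegative and differentiable on `[0,1)`, the Gronwall-type inequality
`E'(t) + ½E_l(t)|v_l(t)| + ½E_r(t)|v_r(t)| ≤ E(t)` holds on `[0,1)`, and yet
`E_l(t) → +∞` as `t → 1⁻`. -/
theorem gronwall_blowup_example :
    let E : ℝ → ℝ := fun t => (Real.exp t + 1) / 2
    let El : ℝ → ℝ := fun t => 1 / (2 * (1 - t))
    let Er : ℝ → ℝ := fun t => 0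
    let vl : ℝ → ℝ := fun t => -1 + t
    let vr : ℝ → ℝ := fun t => 1
    (∀ t ∈ Ico (0:ℝ) 1, 0 ≤ E t ∧ 0 ≤ El t ∧ 0 ≤ Er t) ∧
    (∀ t ∈ Ico (0:ℝ) 1, ∃ dE dEl dEr : ℝ,
      HasDerivAt E dE t ∧ HasDerivAt El dEl t ∧ HasDerivAt Er dEr t ∧
      dE + (1 / 2) * El t * |vl t| + (1 / 2) * Er t * |vr t| ≤ E t) ∧
    Tendsto El (nhdsWithin 1 (Iio (1:ℝ))) atTop := by
  intro E El Er vl vr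
  refine ⟨fun t ht => ⟨by positivity, ?_, le_rfl⟩, fun t ht => ?_, ?_⟩
  · have h : 0 ≤ 1 - t := by linarith [ht.2]
    positivity
  · have h : 0 < 1 - t := by linarith [ht.2]
    have hl : DifferentiableAt ℝ El t := by
      have h0 : 2 * (1 - t) ≠ 0 := by positivity
      exact (differentiableAt_const _).div (by fun_prop) h0
    refine ⟨Real.exp t / 2, deriv El t, 0, ((Real.hasDerivAt_exp t).add_const 1).div_const 2,
      hl.hasDerivAt, hasDerivAt_const t 0, ?_⟩
    have hflux : El t * |vl t| = 1 / 2 := by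
      simp only [El, vl]
      rw [abs_of_neg (by linarith)]
      field_simp
      ring
    simp only [mul_assoc, hflux, E, Er]
    linarith
  · have h : Tendsto (fun t : ℝ => 2 * (1 - t)) (nhdsWithin 1 (Iio 1)) (nhdsWithin 0 (Ioi 0)) := by
      refine tendsto_nhdsWithin_iff.2 ⟨?_, ?_⟩
      · have hc : Continuous fun t : ℝ => 2 * (1 - t) := by fun_prop
        simpa using (hc.tendsto 1).mono_left nhdsWithin_le_nhds
      · filter_upwards [self_mem_nhdsWithin] with t ht
        have ht' : t < 1 := ht
        exact mem_Ioi.2 (by linarith)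
    simpa only [El, one_div] using! h.inv_tendsto_nhdsGT_zero
end

section
/- Let k ≥ 1 be an integer, let a₀, …, a_{k−1} ∈ ℝ, and let g : (0,1) → ℝ be a bounded function. Suppose f : (0,1) → ℝ is k-times differentiable on (0,1) and satisfies the linear ODE f^{(k)}(x) + Σ_{i=0}^{k−1} a_i f^{(i)}(x) = g(x) for every x ∈ (0,1). Then f belongs to W^{k,∞}(0,1); that is, each derivative f^{(i)} for 0 ≤ i ≤ k is bounded on (0,1). -/
open Set

/-- A Grönwall bound on the right half of the unit interval. -/
theorem norm_le_gronwallBound_of_mem_Ico {E : Type*} [NormedAddCommGroup E] [NormedSpace ℝ E]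
    {Y Y' : ℝ → E} {K ε : ℝ} (hK : 0 ≤ K) (hε : 0 ≤ ε)
    (hY : ∀ x ∈ Ioo (0 : ℝ) 1, HasDerivAt Y (Y' x) x)
    (hb : ∀ x ∈ Ioo (0 : ℝ) 1, ‖Y' x‖ ≤ K * ‖Y x‖ + ε) {x : ℝ} (hx : x ∈ Ico (1 / 2 : ℝ) 1) :
    ‖Y x‖ ≤ gronwallBound ‖Y (1 / 2)‖ K ε (1 / 2) := by
  have hsub : ∀ t ∈ Icc (1 / 2 : ℝ) x, t ∈ Ioo (0 : ℝ) 1 := fun t ht =>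
    ⟨by linarith [ht.1], ht.2.trans_lt hx.2⟩
  refine (norm_le_gronwallBound_of_norm_deriv_right_le
    (fun t ht => (hY t (hsub t ht)).continuousAt.continuousWithinAt)
    (fun t ht => (hY t (hsub t (Ico_subset_Icc_self ht))).hasDerivWithinAt) le_rfl
    (fun t ht => hb t (hsub t (Ico_subset_Icc_self ht))) x (right_mem_Icc.2 hx.1)).trans ?_
  exact gronwallBound_mono (norm_nonneg _) hε hK (by linarith [hx.2])

/-- A function on the unit interval whose derivative grows at most affinely is bounded. -/
theorem norm_le_gronwallBound_of_mem_Ioo {E : Type*} [NormedAddCommGroup E] [NormedSpace ℝ E]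
    {Y Y' : ℝ → E} {K ε : ℝ} (hK : 0 ≤ K) (hε : 0 ≤ ε)
    (hY : ∀ x ∈ Ioo (0 : ℝ) 1, HasDerivAt Y (Y' x) x)
    (hb : ∀ x ∈ Ioo (0 : ℝ) 1, ‖Y' x‖ ≤ K * ‖Y x‖ + ε) {x : ℝ} (hx : x ∈ Ioo (0 : ℝ) 1) :
    ‖Y x‖ ≤ gronwallBound ‖Y (1 / 2)‖ K ε (1 / 2) := by
  rcases le_total (1 / 2) x with h | h
  · exact norm_le_gronwallBound_of_mem_Ico hK hε hY hb ⟨h, hx.2⟩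
  · have hmem : ∀ t ∈ Ioo (0 : ℝ) 1, 1 - t ∈ Ioo (0 : ℝ) 1 := fun t ht =>
      ⟨by linarith [ht.2], by linarith [ht.1]⟩
    have key := norm_le_gronwallBound_of_mem_Ico (Y := fun t => Y (1 - t))
      (Y' := fun t => -Y' (1 - t)) hK hε
      (fun t ht => HasDerivAt.comp_const_sub 1 t (hY _ (hmem t ht)))
      (fun t ht => by simpa only [norm_neg] using hb _ (hmem t ht))
      (x := 1 - x) ⟨by linarith, by linarith [hx.1]⟩
    have hhalf : (1 : ℝ) - 1 / 2 = 1 / 2 := by norm_num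
    simpa only [sub_sub_cancel, hhalf] using key

/-- **ODE regularity lemma (Lemma 1.11).**
Let `k ≥ 1`, `a₀, …, a_{k−1} ∈ ℝ` and let `g : (0,1) → ℝ` be bounded.  If `f` is `k`-times
differentiable on `(0,1)` and satisfies `f^{(k)} + Σ_{i<k} aᵢ f^{(i)} = g` on `(0,1)`,
then `f ∈ W^{k,∞}(0,1)`: each derivative `f^{(i)}`, `0 ≤ i ≤ k`, is bounded on `(0,1)`. -/
theorem ode_W_k_infty_regularity
    (k : ℕ) (hk : 1 ≤ k) (a : ℕ → ℝ) (f g : ℝ → ℝ)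
    (hg : ∃ M : ℝ, ∀ x ∈ Ioo (0:ℝ) 1, |g x| ≤ M)
    (hf : ∀ i < k, DifferentiableOn ℝ (iteratedDeriv i f) (Ioo (0:ℝ) 1))
    (hode : ∀ x ∈ Ioo (0:ℝ) 1,
      iteratedDeriv k f x + ∑ i ∈ Finset.range k, a i * iteratedDeriv i f x = g x) :
    ∀ i ≤ k, ∃ M : ℝ, ∀ x ∈ Ioo (0:ℝ) 1, |iteratedDeriv i f x| ≤ M := by
  obtain ⟨M, hM⟩ := hg
  have hM0 : 0 ≤ M := (abs_nonneg _).trans (hM (1 / 2) ⟨by norm_num, by norm_num⟩)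
  set S : ℝ := ∑ i ∈ Finset.range k, |a i| with hS
  have hS0 : 0 ≤ S := Finset.sum_nonneg fun i _ => abs_nonneg _
  set Y : ℝ → Fin k → ℝ := fun x i => iteratedDeriv i f x with hYdef
  have hcoord : ∀ x, ∀ i < k, |iteratedDeriv i f x| ≤ ‖Y x‖ := fun x i hi =>
    norm_le_pi_norm (Y x) ⟨i, hi⟩
  have htop : ∀ x ∈ Ioo (0 : ℝ) 1, |iteratedDeriv k f x| ≤ S * ‖Y x‖ + M := by
    intro x hx
    have hsum : |∑ i ∈ Finset.range k, a i * iteratedDeriv i f x| ≤ S * ‖Y x‖ := by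
      rw [hS, Finset.sum_mul]
      refine (Finset.abs_sum_le_sum_abs _ _).trans (Finset.sum_le_sum fun i hi => ?_)
      rw [abs_mul]
      exact mul_le_mul_of_nonneg_left (hcoord x i (Finset.mem_range.1 hi)) (abs_nonneg _)
    rw [eq_sub_of_add_eq (hode x hx)]
    linarith [abs_sub (g x) (∑ i ∈ Finset.range k, a i * iteratedDeriv i f x), hM x hx]
  have hY : ∀ x ∈ Ioo (0 : ℝ) 1,
      HasDerivAt Y (fun i : Fin k => iteratedDeriv (i + 1) f x) x := by
    intro x hx
    refine hasDerivAt_pi.2 fun i => ?_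
    rw [iteratedDeriv_succ]
    exact ((hf i i.2).differentiableAt (isOpen_Ioo.mem_nhds hx)).hasDerivAt
  have hb : ∀ x ∈ Ioo (0 : ℝ) 1,
      ‖fun i : Fin k => iteratedDeriv (i + 1) f x‖ ≤ (1 + S) * ‖Y x‖ + M := by
    intro x hx
    have hn := norm_nonneg (Y x)
    have hSn := mul_nonneg hS0 hn
    refine (pi_norm_le_iff_of_nonneg (by positivity)).2 fun i => ?_
    rw [Real.norm_eq_abs]
    rcases Nat.lt_or_ge (i + 1) k with h | h
    · linarith [hcoord x _ h]
    · rw [show (i : ℕ) + 1 = k by omega]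
      linarith [htop x hx]
  set B := gronwallBound ‖Y (1 / 2)‖ (1 + S) M (1 / 2)
  have hB : ∀ x ∈ Ioo (0 : ℝ) 1, ‖Y x‖ ≤ B := fun x hx =>
    norm_le_gronwallBound_of_mem_Ioo (by positivity) hM0 hY hb hx
  intro i hi
  rcases hi.lt_or_eq with h | rfl
  · exact ⟨B, fun x hx => (hcoord x i h).trans (hB x hx)⟩
  · exact ⟨S * B + M, fun x hx => (htop x hx).trans
      (by linarith [mul_le_mul_of_nonneg_left (hB x hx) hS0])⟩
end

section
/- For every integer n ≥ 1 there exists a constant C > 0, depending only on n, such that for every v ∈ C^{2n}([0,1]): max_{0 ≤ j ≤ 2n} sup_{x ∈ [0,1]} |v^{(j)}(x)| ≤ C ( sup_{x ∈ [0,1]} |(Aₙv)(x)| + Σ_{i=0}^{n−1} ( |v^{(i)}(0)| + |v^{(i)}(1)| ) ). -/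
open Set

/-- The operator `Aₙ f = Σ_{k=0}^{n} (−1)^k f^{(2k)}`, with derivatives taken within `[0,1]`. -/
noncomputable def opA (n : ℕ) (f : ℝ → ℝ) (x : ℝ) : ℝ :=
  ∑ k ∈ Finset.range (n + 1), (-1 : ℝ) ^ k * iteratedDerivWithin (2 * k) f (Icc (0:ℝ) 1) x

/-- The first `2n` derivatives of a function, extended by the value `f^{(2n)}` prescribed by
the homogeneous equation `Aₙ f = 0`. -/
noncomputable def opAJet (n j : ℕ) : (Fin (2 * n) → ℝ) →ₗ[ℝ] ℝ :=
  if h : j < 2 * n then LinearMap.proj ⟨j, h⟩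
  else (-1 : ℝ) ^ (n + 1) •
    ∑ k : Fin n, (-1 : ℝ) ^ (k : ℕ) • LinearMap.proj (⟨2 * k, by omega⟩ : Fin (2 * n))

/-- The companion matrix of the homogeneous equation `Aₙ f = 0`, as a continuous linear map. -/
noncomputable def opACompanion (n : ℕ) : (Fin (2 * n) → ℝ) →L[ℝ] (Fin (2 * n) → ℝ) :=
  LinearMap.toContinuousLinearMap (LinearMap.pi fun i => opAJet n (i + 1))

theorem opAJet_of_lt {n j : ℕ} (h : j < 2 * n) (c : Fin (2 * n) → ℝ) :
    opAJet n j c = c ⟨j, h⟩ := by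
  simp [opAJet, h]

theorem opAJet_two_mul_self (n : ℕ) (c : Fin (2 * n) → ℝ) :
    opAJet n (2 * n) c
      = (-1 : ℝ) ^ (n + 1) * ∑ k ∈ Finset.range n, (-1 : ℝ) ^ k * opAJet n (2 * k) c := by
  rw [Finset.sum_range]
  have h (k : Fin n) : opAJet n (2 * k) c = c ⟨2 * k, by omega⟩ := opAJet_of_lt (by omega) c
  simp only [h]
  simp [opAJet]

theorem sum_opAJet (n : ℕ) (c : Fin (2 * n) → ℝ) :
    ∑ k ∈ Finset.range (n + 1), (-1 : ℝ) ^ k * opAJet n (2 * k) c = 0 := by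
  rw [Finset.sum_range_succ, opAJet_two_mul_self, ← mul_assoc, ← pow_add]
  rw [show n + (n + 1) = 2 * n + 1 by ring, pow_succ, pow_mul]
  simp

@[simp]
theorem opACompanion_apply (n : ℕ) (c : Fin (2 * n) → ℝ) (i : Fin (2 * n)) :
    opACompanion n c i = opAJet n (i + 1) c := rfl

/-- The Dirichlet energy identity: integrating `f · f^{(2k)}` by parts `i` times. -/
theorem integral_mul_eq_of_boundary_zero {n : ℕ} {F : ℕ → ℝ → ℝ}
    (hF : ∀ j < 2 * n, ∀ x, HasDerivAt (F j) (F (j + 1) x) x)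
    (hc : ∀ j ≤ 2 * n, Continuous (F j))
    (h0 : ∀ i < n, F i 0 = 0) (h1 : ∀ i < n, F i 1 = 0) {k : ℕ} (hk : k ≤ n) :
    ∀ i ≤ k, ∫ x in (0:ℝ)..1, F 0 x * F (2 * k) x
      = (-1 : ℝ) ^ i * ∫ x in (0:ℝ)..1, F i x * F (2 * k - i) x := by
  intro i
  induction i with
  | zero => simp
  | succ i ih =>
    intro hi
    rw [ih (by omega)]
    obtain ⟨m, hm⟩ : ∃ m, 2 * k - i = m + 1 := ⟨2 * k - i - 1, by omega⟩
    have hm' : 2 * k - (i + 1) = m := by omega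
    rw [hm, hm', intervalIntegral.integral_mul_deriv_eq_deriv_mul
      (u := F i) (v := F m) (u' := F (i + 1)) (v' := F (m + 1))
      (fun x _ => hF i (by omega) x) (fun x _ => hF m (by omega) x)
      ((hc _ (by omega)).intervalIntegrable _ _) ((hc _ (by omega)).intervalIntegrable _ _)]
    rw [h0 i (by omega), h1 i (by omega)]
    ring

/-- Uniqueness for the homogeneous Dirichlet problem `Aₙ f = 0`. -/
theorem eq_zero_of_opA_eq_zero {n : ℕ} {F : ℕ → ℝ → ℝ}
    (hF : ∀ j < 2 * n, ∀ x, HasDerivAt (F j) (F (j + 1) x) x)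
    (hc : ∀ j ≤ 2 * n, Continuous (F j))
    (hA : ∀ x, ∑ k ∈ Finset.range (n + 1), (-1 : ℝ) ^ k * F (2 * k) x = 0)
    (h0 : ∀ i < n, F i 0 = 0) (h1 : ∀ i < n, F i 1 = 0) :
    ∀ j ≤ 2 * n, ∀ x ∈ Icc (0:ℝ) 1, F j x = 0 := by
  have henergy : ∑ k ∈ Finset.range (n + 1), ∫ x in (0:ℝ)..1, F k x ^ 2 = 0 := by
    calc ∑ k ∈ Finset.range (n + 1), ∫ x in (0:ℝ)..1, F k x ^ 2
        = ∑ k ∈ Finset.range (n + 1),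
            ∫ x in (0:ℝ)..1, F 0 x * ((-1 : ℝ) ^ k * F (2 * k) x) := by
          refine Finset.sum_congr rfl fun k hk => ?_
          have hk' : k ≤ n := by simpa [Nat.lt_succ_iff] using hk
          have h := integral_mul_eq_of_boundary_zero hF hc h0 h1 hk' k le_rfl
          rw [show 2 * k - k = k by omega] at h
          simp_rw [mul_left_comm (F 0 _)]
          rw [intervalIntegral.integral_const_mul, h, ← mul_assoc, ← pow_add, ← two_mul, pow_mul]
          simp [pow_two]
      _ = ∫ x in (0:ℝ)..1, F 0 x * ∑ k ∈ Finset.range (n + 1), (-1 : ℝ) ^ k * F (2 * k) x := by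
          rw [← intervalIntegral.integral_finsetSum]
          · simp_rw [Finset.mul_sum]
          · intro k hk
            have hk' : k ≤ n := by simpa [Nat.lt_succ_iff] using hk
            exact ((hc 0 (by omega)).mul
              (continuous_const.mul (hc (2 * k) (by omega)))).intervalIntegrable _ _
      _ = 0 := by simp [hA]
  have hint : ∫ x in (0:ℝ)..1, F 0 x ^ 2 = 0 :=
    (Finset.sum_eq_zero_iff_of_nonneg fun k _ =>
      intervalIntegral.integral_nonneg zero_le_one fun x _ => sq_nonneg (F k x)).1
      henergy 0 (by simp)
  intro j
  induction j with
  | zero =>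
    intro _ x hx
    by_contra hne
    have hpos : 0 < ∫ x in (0:ℝ)..1, F 0 x ^ 2 :=
      intervalIntegral.integral_pos zero_lt_one (((hc 0 (by omega)).pow 2).continuousOn)
        (fun y _ => sq_nonneg _) ⟨x, hx, by positivity⟩
    exact hpos.ne' hint
  | succ j ih =>
    intro hj x hx
    have hd : HasDerivWithinAt (F j) 0 (Icc 0 1) x :=
      (hasDerivWithinAt_const x (Icc (0:ℝ) 1) (0:ℝ)).congr (fun y hy => ih (by omega) y hy)
        (ih (by omega) x hx)
    exact (uniqueDiffOn_Icc_zero_one x hx).eq_deriv _ (hF j (by omega) x).hasDerivWithinAt hd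

/-- Growth estimate on `[0,1]` for a linear system with bounded forcing. -/
theorem norm_le_of_hasDerivWithinAt_linear {E : Type*} [NormedAddCommGroup E] [NormedSpace ℝ E]
    (M : E →L[ℝ] E) {f G : ℝ → E} {ε : ℝ}
    (hf : ∀ x ∈ Icc (0:ℝ) 1, HasDerivWithinAt f (M (f x) + G x) (Icc 0 1) x)
    (hG : ∀ x ∈ Icc (0:ℝ) 1, ‖G x‖ ≤ ε) :
    ∀ x ∈ Icc (0:ℝ) 1, ‖f x‖ ≤ Real.exp (‖M‖ + 1) * (‖f 0‖ + ε) := by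
  intro x hx
  have hε : 0 ≤ ε := (norm_nonneg _).trans (hG x hx)
  have hM : 0 ≤ ‖M‖ := norm_nonneg M
  have hg := norm_le_gronwallBound_of_norm_deriv_right_le (f := f)
    (f' := fun x => M (f x) + G x) (δ := ‖f 0‖) (K := ‖M‖ + 1) (ε := ε) (a := 0) (b := 1)
    (fun y hy => (hf y hy).continuousWithinAt)
    (fun y hy => (hf y (Ico_subset_Icc_self hy)).mono_of_mem_nhdsWithin
      (Icc_mem_nhdsGE_of_mem hy)) le_rfl
    (fun y hy => by
      have h1 := norm_add_le (M (f y)) (G y)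
      have h2 := M.le_opNorm (f y)
      have h3 := hG y (Ico_subset_Icc_self hy)
      have h4 := norm_nonneg (f y)
      linarith) x hx
  rw [gronwallBound_of_K_ne_0 (by positivity), sub_zero] at hg
  have he : Real.exp ((‖M‖ + 1) * x) ≤ Real.exp (‖M‖ + 1) :=
    Real.exp_le_exp.2 (mul_le_of_le_one_right (by positivity) hx.2)
  have h1 : ‖f 0‖ * Real.exp ((‖M‖ + 1) * x) ≤ ‖f 0‖ * Real.exp (‖M‖ + 1) := by gcongr
  have h2 : ε / (‖M‖ + 1) * (Real.exp ((‖M‖ + 1) * x) - 1) ≤ ε * Real.exp (‖M‖ + 1) := by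
    have : ε / (‖M‖ + 1) ≤ ε := div_le_self hε (by linarith)
    have : 0 ≤ ε / (‖M‖ + 1) := by positivity
    have := Real.exp_pos (‖M‖ + 1)
    calc _ ≤ ε / (‖M‖ + 1) * Real.exp (‖M‖ + 1) := by gcongr; linarith
      _ ≤ _ := by gcongr
  linarith

/-- The solution of the homogeneous system `Aₙ f = 0` with initial jet `c`. -/
noncomputable def opAFlow (n : ℕ) (c : Fin (2 * n) → ℝ) (x : ℝ) : Fin (2 * n) → ℝ :=
  NormedSpace.exp (x • opACompanion n) c

theorem opAFlow_zero (n : ℕ) (c : Fin (2 * n) → ℝ) : opAFlow n c 0 = c := by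
  simp [opAFlow]

theorem hasDerivAt_opAFlow (n : ℕ) (c : Fin (2 * n) → ℝ) (x : ℝ) :
    HasDerivAt (opAFlow n c) (opACompanion n (opAFlow n c x)) x :=
  (ContinuousLinearMap.apply ℝ (Fin (2 * n) → ℝ) c).hasFDerivAt.comp_hasDerivAt x
    (hasDerivAt_exp_smul_const' (opACompanion n) x)

/-- Initial jets mapped to the Dirichlet data of the corresponding homogeneous solution. -/
noncomputable def opABoundary (n : ℕ) :
    (Fin (2 * n) → ℝ) →ₗ[ℝ] (Fin n → ℝ) × (Fin n → ℝ) :=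
  let restrict : (Fin (2 * n) → ℝ) →ₗ[ℝ] (Fin n → ℝ) :=
    LinearMap.funLeft ℝ ℝ (Fin.castLE (by omega))
  restrict.prod (restrict ∘ₗ (NormedSpace.exp (opACompanion n)).toLinearMap)

theorem opABoundary_apply (n : ℕ) (c : Fin (2 * n) → ℝ) :
    opABoundary n c = (fun i => c (Fin.castLE (by omega) i),
      fun i => opAFlow n c 1 (Fin.castLE (by omega) i)) := by
  simp only [opAFlow, one_smul]
  rfl

theorem opABoundary_injective (n : ℕ) : Function.Injective (opABoundary n) := by
  refine (injective_iff_map_eq_zero _).2 fun c hc => ?_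
  rw [opABoundary_apply, Prod.mk_eq_zero] at hc
  have hcont : Continuous (opAFlow n c) :=
    continuous_iff_continuousAt.2 fun x => (hasDerivAt_opAFlow n c x).continuousAt
  have h := eq_zero_of_opA_eq_zero (n := n) (F := fun j x => opAJet n j (opAFlow n c x))
    (fun j hj x => by
      have := hasDerivAt_pi.1 (hasDerivAt_opAFlow n c x) ⟨j, hj⟩
      simpa only [opAJet_of_lt hj, opACompanion_apply] using this)
    (fun j _ => (opAJet n j).continuous_of_finiteDimensional.comp hcont)
    (fun x => sum_opAJet n _)
    (fun i hi => by
      simp only [opAFlow_zero]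
      rw [opAJet_of_lt (by omega)]
      exact congrFun hc.1 ⟨i, hi⟩)
    (fun i hi => by
      rw [opAJet_of_lt (by omega)]
      exact congrFun hc.2 ⟨i, hi⟩)
  ext i
  have := h i (by omega) 0 (by simp)
  simpa only [opAFlow_zero, opAJet_of_lt i.2, Pi.zero_apply] using this

/-- The jet of a `C^{2n}` function solves the companion system with forcing `± Aₙ v`. -/
theorem hasDerivWithinAt_jet {n : ℕ} {v : ℝ → ℝ}
    (hv : ContDiffOn ℝ (2 * n : ℕ) v (Icc (0:ℝ) 1)) {x : ℝ} (hx : x ∈ Icc (0:ℝ) 1) :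
    HasDerivWithinAt (fun y (i : Fin (2 * n)) => iteratedDerivWithin i v (Icc (0:ℝ) 1) y)
      (opACompanion n (fun i => iteratedDerivWithin i v (Icc (0:ℝ) 1) x) +
        fun i : Fin (2 * n) => if (i : ℕ) + 1 = 2 * n then (-1 : ℝ) ^ n * opA n v x else 0)
      (Icc 0 1) x := by
  rw [hasDerivWithinAt_pi]
  intro i
  have hd : HasDerivWithinAt (iteratedDerivWithin i v (Icc (0:ℝ) 1))
      (iteratedDerivWithin (i + 1) v (Icc (0:ℝ) 1) x) (Icc 0 1) x := by
    rw [iteratedDerivWithin_succ]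
    exact (hv.differentiableOn_iteratedDerivWithin (by exact_mod_cast i.2)
      uniqueDiffOn_Icc_zero_one x hx).hasDerivWithinAt
  refine hd.congr_deriv (Eq.symm ?_)
  simp only [Pi.add_apply, opACompanion_apply]
  split_ifs with h
  · rw [h, opAJet_two_mul_self, opA, Finset.sum_range_succ, mul_add, ← mul_assoc, ← pow_add,
      ← two_mul n, pow_mul]
    have : ∀ k ∈ Finset.range n, (-1 : ℝ) ^ k * opAJet n (2 * k)
        (fun i => iteratedDerivWithin i v (Icc (0:ℝ) 1) x)
        = (-1 : ℝ) ^ k * iteratedDerivWithin (2 * k) v (Icc (0:ℝ) 1) x := by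
      intro k hk
      rw [opAJet_of_lt (by have := Finset.mem_range.1 hk; omega)]
    rw [Finset.sum_congr rfl this]
    norm_num
    ring
  · rw [opAJet_of_lt (by omega), add_zero]

/-- The top-order derivative is controlled by `Aₙ v` and the lower-order derivatives. -/
theorem abs_iteratedDerivWithin_two_mul_le {n : ℕ} {v : ℝ → ℝ} {x D K : ℝ}
    (hK : |opA n v x| ≤ K)
    (hD : ∀ j < 2 * n, |iteratedDerivWithin j v (Icc (0:ℝ) 1) x| ≤ D) :
    |iteratedDerivWithin (2 * n) v (Icc (0:ℝ) 1) x| ≤ K + n * D := by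
  have hsum : |∑ k ∈ Finset.range n,
      (-1 : ℝ) ^ k * iteratedDerivWithin (2 * k) v (Icc (0:ℝ) 1) x| ≤ n * D := by
    refine (Finset.abs_sum_le_sum_abs _ _).trans ?_
    refine (Finset.sum_le_card_nsmul _ _ D fun k hk => ?_).trans (by simp)
    simpa [abs_mul] using hD (2 * k) (by have := Finset.mem_range.1 hk; omega)
  have htop : (-1 : ℝ) ^ n * iteratedDerivWithin (2 * n) v (Icc (0:ℝ) 1) x = opA n v x -
      ∑ k ∈ Finset.range n, (-1 : ℝ) ^ k * iteratedDerivWithin (2 * k) v (Icc (0:ℝ) 1) x := by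
    rw [opA, Finset.sum_range_succ]
    ring
  calc |iteratedDerivWithin (2 * n) v (Icc (0:ℝ) 1) x|
      = |(-1 : ℝ) ^ n * iteratedDerivWithin (2 * n) v (Icc (0:ℝ) 1) x| := by simp [abs_mul]
    _ ≤ _ := by rw [htop]; exact (abs_sub _ _).trans (add_le_add hK hsum)

/-- **`L^∞`–`W^{2n,∞}` elliptic estimate for `Aₙ` (Lemma 1.9).**
For every `n ≥ 1` there is a constant `C > 0` depending only on `n` such that for every
`v ∈ C^{2n}([0,1])` and every bound `K` on `sup_{[0,1]} |Aₙv|`: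
`max_{j ≤ 2n} sup_{[0,1]} |v^{(j)}| ≤ C (K + Σ_{i=0}^{n−1} (|v^{(i)}(0)| + |v^{(i)}(1)|))`. -/
theorem opA_Linfty_W2ninfty_estimate (n : ℕ) (hn : 1 ≤ n) :
    ∃ C > (0:ℝ), ∀ v : ℝ → ℝ, ContDiffOn ℝ (2 * n : ℕ) v (Icc (0:ℝ) 1) →
      ∀ K : ℝ, (∀ x ∈ Icc (0:ℝ) 1, |opA n v x| ≤ K) →
      ∀ j ≤ 2 * n, ∀ x ∈ Icc (0:ℝ) 1,
        |iteratedDerivWithin j v (Icc (0:ℝ) 1) x|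
          ≤ C * (K + ∑ i ∈ Finset.range n,
              (|iteratedDerivWithin i v (Icc (0:ℝ) 1) 0|
                + |iteratedDerivWithin i v (Icc (0:ℝ) 1) 1|)) := by
  obtain ⟨A, -, hA⟩ := (opABoundary n).exists_antilipschitzWith
    (LinearMap.ker_eq_bot.2 (opABoundary_injective n))
  set P : ℝ := Real.exp (‖opACompanion n‖ + 1)
  have hP : 0 < P := Real.exp_pos _
  set D : ℝ := P * (A * (1 + P) + 1)
  have hD : 0 < D := by positivity
  refine ⟨D + (1 + n * D), by positivity, fun v hv K hK => ?_⟩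
  have hK0 : 0 ≤ K := (abs_nonneg _).trans (hK 0 (by simp))
  set B := ∑ i ∈ Finset.range n, (|iteratedDerivWithin i v (Icc (0:ℝ) 1) 0|
    + |iteratedDerivWithin i v (Icc (0:ℝ) 1) 1|)
  have hBterm (i : ℕ) (hi : i < n) : |iteratedDerivWithin i v (Icc (0:ℝ) 1) 0|
      + |iteratedDerivWithin i v (Icc (0:ℝ) 1) 1| ≤ B :=
    Finset.single_le_sum (f := fun i => |iteratedDerivWithin i v (Icc (0:ℝ) 1) 0|
      + |iteratedDerivWithin i v (Icc (0:ℝ) 1) 1|) (fun _ _ => by positivity)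
      (Finset.mem_range.2 hi)
  have hB : 0 ≤ B := Finset.sum_nonneg fun _ _ => by positivity
  let V : ℝ → Fin (2 * n) → ℝ := fun y i => iteratedDerivWithin i v (Icc (0:ℝ) 1) y
  let G : ℝ → Fin (2 * n) → ℝ := fun y i =>
    if (i : ℕ) + 1 = 2 * n then (-1 : ℝ) ^ n * opA n v y else 0
  have hV : ∀ y ∈ Icc (0:ℝ) 1, HasDerivWithinAt V (opACompanion n (V y) + G y) (Icc 0 1) y :=
    fun y hy => hasDerivWithinAt_jet hv hy
  have hG : ∀ y ∈ Icc (0:ℝ) 1, ‖G y‖ ≤ K := by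
    intro y hy
    refine (pi_norm_le_iff_of_nonneg hK0).2 fun i => ?_
    simp only [G]
    split_ifs
    · simpa [abs_mul] using hK y hy
    · simpa using hK0
  have hW : ‖V 1 - opAFlow n (V 0) 1‖ ≤ P * K := by
    have := norm_le_of_hasDerivWithinAt_linear (opACompanion n)
      (f := fun y => V y - opAFlow n (V 0) y) (fun y hy => by
        convert (hV y hy).sub (hasDerivAt_opAFlow n (V 0) y).hasDerivWithinAt using 1
        · rfl
        · rw [map_sub]
          abel) hG 1 (by simp)
    simpa [opAFlow_zero] using this
  have hbdry : ‖opABoundary n (V 0)‖ ≤ B + P * K := by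
    have hPK : 0 ≤ P * K := by positivity
    rw [opABoundary_apply]
    refine max_le ?_ ?_ <;> refine (pi_norm_le_iff_of_nonneg (by positivity)).2 fun i => ?_
    · have h1 := hBterm i i.2
      have h2 := abs_nonneg (iteratedDerivWithin i v (Icc (0:ℝ) 1) 1)
      change |iteratedDerivWithin i v (Icc (0:ℝ) 1) 0| ≤ _
      linarith
    · have h1 := hBterm i i.2
      have h2 := abs_nonneg (iteratedDerivWithin i v (Icc (0:ℝ) 1) 0)
      have h3 := (norm_le_pi_norm _ (Fin.castLE (by omega) i)).trans hW
      have h4 := norm_sub_norm_le (opAFlow n (V 0) 1 (Fin.castLE (by omega) i))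
        (V 1 (Fin.castLE (by omega) i))
      rw [norm_sub_rev] at h4
      have h5 : ‖V 1 (Fin.castLE (by omega) i)‖ = |iteratedDerivWithin i v (Icc (0:ℝ) 1) 1| := rfl
      rw [Pi.sub_apply] at h3
      linarith
  have hV0 : ‖V 0‖ ≤ A * (B + P * K) := by
    have := hA.le_mul_dist (V 0) 0
    rw [map_zero, dist_zero_right, dist_zero_right] at this
    exact this.trans (by gcongr)
  have hlow : ∀ j < 2 * n, ∀ x ∈ Icc (0:ℝ) 1,
      |iteratedDerivWithin j v (Icc (0:ℝ) 1) x| ≤ D * (K + B) := by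
    intro j hj x hx
    calc |iteratedDerivWithin j v (Icc (0:ℝ) 1) x| = ‖V x ⟨j, hj⟩‖ := rfl
      _ ≤ ‖V x‖ := norm_le_pi_norm _ _
      _ ≤ P * (‖V 0‖ + K) := norm_le_of_hasDerivWithinAt_linear _ hV hG x hx
      _ ≤ P * (A * (B + P * K) + K) := by gcongr
      _ ≤ P * (A * ((1 + P) * (K + B)) + (K + B)) := by
          gcongr
          · nlinarith [mul_nonneg hP.le hB]
          · linarith
      _ = D * (K + B) := by ring
  intro j hj x hx
  have hKB : 0 ≤ K + B := by positivity
  rcases hj.lt_or_eq with hj | rfl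
  · have : 0 ≤ (1 + n * D) * (K + B) := by positivity
    linarith [hlow j hj x hx]
  · have htop := abs_iteratedDerivWithin_two_mul_le (hK x hx) fun j hj => hlow j hj x hx
    have : 0 ≤ D * (K + B) := by positivity
    linarith
end

section
/- Let n ≥ 1 be an integer, f ∈ C^{2n}([0,1]) and g ∈ C^{n}([0,1]). Then the iterated integration-by-parts identity holds: ∫₀¹ (Aₙf)(x) g(x) dx = Σ_{i=0}^{n} ∫₀¹ f^{(i)}(x) g^{(i)}(x) dx + Σ_{i=0}^{n−1} ( Bᵢ(f)(1) g^{(i)}(1) − Bᵢ(f)(0) g^{(i)}(0) ). -/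
open Set

/-- The boundary operator `Bᵢ(f)(x) = Σ_{k=i+1}^{n} (−1)^{k+i} f^{(2k−1−i)}(x)`. -/
noncomputable def opB (n i : ℕ) (f : ℝ → ℝ) (x : ℝ) : ℝ :=
  ∑ k ∈ Finset.Icc (i + 1) n,
    (-1 : ℝ) ^ (k + i) * iteratedDerivWithin (2 * k - 1 - i) f (Icc (0:ℝ) 1) x

/-- Integration by parts for iterated derivatives within a nondegenerate compact interval. -/
theorem integral_iteratedDerivWithin_succ_mul {a b : ℝ} (hab : a < b)
    {p q : WithTop ℕ∞} {f g : ℝ → ℝ}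
    (hf : ContDiffOn ℝ p f (Icc a b)) (hg : ContDiffOn ℝ q g (Icc a b))
    {m j : ℕ} (hm : ((m + 1 : ℕ) : WithTop ℕ∞) ≤ p) (hj : ((j + 1 : ℕ) : WithTop ℕ∞) ≤ q) :
    ∫ x in a..b, iteratedDerivWithin (m + 1) f (Icc a b) x * iteratedDerivWithin j g (Icc a b) x
      = iteratedDerivWithin m f (Icc a b) b * iteratedDerivWithin j g (Icc a b) b
        - iteratedDerivWithin m f (Icc a b) a * iteratedDerivWithin j g (Icc a b) a
        - ∫ x in a..b,
            iteratedDerivWithin m f (Icc a b) x * iteratedDerivWithin (j + 1) g (Icc a b) x := by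
  have hs := uniqueDiffOn_Icc hab
  have key {r : WithTop ℕ∞} {h : ℝ → ℝ} (hh : ContDiffOn ℝ r h (Icc a b)) {l : ℕ}
      (hl : ((l + 1 : ℕ) : WithTop ℕ∞) ≤ r) :
      (∀ x ∈ uIcc a b, HasDerivWithinAt (iteratedDerivWithin l h (Icc a b))
        (iteratedDerivWithin (l + 1) h (Icc a b) x) (uIcc a b) x) ∧
      IntervalIntegrable (iteratedDerivWithin (l + 1) h (Icc a b)) MeasureTheory.volume a b := by
    have hlt : (l : WithTop ℕ∞) < r :=
      lt_of_lt_of_le (by exact_mod_cast Nat.lt_succ_self l) hl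
    refine ⟨fun x hx => ?_, ?_⟩
    · rw [uIcc_of_le hab.le] at hx ⊢
      rw [iteratedDerivWithin_succ]
      exact (hh.differentiableOn_iteratedDerivWithin hlt hs x hx).hasDerivWithinAt
    · exact (hh.continuousOn_iteratedDerivWithin hl hs).intervalIntegrable_of_Icc hab.le
  obtain ⟨hf₁, hf₂⟩ := key hf hm
  obtain ⟨hg₁, hg₂⟩ := key hg hj
  have := intervalIntegral.integral_mul_deriv_eq_deriv_mul_of_hasDerivWithinAt hf₁ hg₁ hf₂ hg₂
  linarith

/-- Moving `j` derivatives from `f^{(2k)}` onto `g`. -/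
theorem integral_iteratedDerivWithin_two_mul_mul {a b : ℝ} (hab : a < b) {n : ℕ} {f g : ℝ → ℝ}
    (hf : ContDiffOn ℝ (2 * n : ℕ) f (Icc a b)) (hg : ContDiffOn ℝ (n : ℕ) g (Icc a b))
    {k j : ℕ} (hk : k ≤ n) (hj : j ≤ k) :
    (-1 : ℝ) ^ k * ∫ x in a..b, iteratedDerivWithin (2 * k) f (Icc a b) x * g x
      = (-1 : ℝ) ^ (k + j) * (∫ x in a..b,
          iteratedDerivWithin (2 * k - j) f (Icc a b) x * iteratedDerivWithin j g (Icc a b) x)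
        + ∑ i ∈ Finset.range j, (-1 : ℝ) ^ (k + i) *
            (iteratedDerivWithin (2 * k - 1 - i) f (Icc a b) b * iteratedDerivWithin i g (Icc a b) b
              - iteratedDerivWithin (2 * k - 1 - i) f (Icc a b) a
                * iteratedDerivWithin i g (Icc a b) a) := by
  induction j with
  | zero => simp
  | succ j ih =>
    obtain ⟨m, hm⟩ : ∃ m, 2 * k = m + 1 + j := ⟨2 * k - 1 - j, by omega⟩
    rw [ih (by omega), Finset.sum_range_succ, show 2 * k - j = m + 1 by omega,
      show 2 * k - (j + 1) = m by omega, show 2 * k - 1 - j = m by omega,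
      integral_iteratedDerivWithin_succ_mul hab hf hg
        (by exact_mod_cast (by omega : m + 1 ≤ 2 * n))
        (by exact_mod_cast (by omega : j + 1 ≤ n))]
    ring

/-- **Iterated integration by parts for `Aₙ` (Lemma A.1).**
For `n ≥ 1`, `f ∈ C^{2n}([0,1])` and `g ∈ C^{n}([0,1])`:
`∫₀¹ (Aₙf) g = Σ_{i=0}^{n} ∫₀¹ f^{(i)} g^{(i)} + Σ_{i=0}^{n−1} [Bᵢ(f) g^{(i)}]₀¹`. -/
theorem opA_iterated_integration_by_parts
    (n : ℕ) (hn : 1 ≤ n) (f g : ℝ → ℝ)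
    (hf : ContDiffOn ℝ (2 * n : ℕ) f (Icc (0:ℝ) 1))
    (hg : ContDiffOn ℝ (n : ℕ) g (Icc (0:ℝ) 1)) :
    (∫ x in (0:ℝ)..1, opA n f x * g x)
      = (∑ i ∈ Finset.range (n + 1), ∫ x in (0:ℝ)..1,
          iteratedDerivWithin i f (Icc (0:ℝ) 1) x * iteratedDerivWithin i g (Icc (0:ℝ) 1) x)
        + ∑ i ∈ Finset.range n,
            (opB n i f 1 * iteratedDerivWithin i g (Icc (0:ℝ) 1) 1
              - opB n i f 0 * iteratedDerivWithin i g (Icc (0:ℝ) 1) 0) := by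
  have hs := uniqueDiffOn_Icc (zero_lt_one (α := ℝ))
  have hint : ∀ k ∈ Finset.range (n + 1), IntervalIntegrable
      (fun x => (-1 : ℝ) ^ k * (iteratedDerivWithin (2 * k) f (Icc (0:ℝ) 1) x * g x))
      MeasureTheory.volume 0 1 := by
    intro k hk
    have hk' : k ≤ n := Finset.mem_range_succ_iff.mp hk
    refine ContinuousOn.intervalIntegrable_of_Icc zero_le_one (continuousOn_const.mul ?_)
    exact (hf.continuousOn_iteratedDerivWithin
      (by exact_mod_cast (by omega : 2 * k ≤ 2 * n)) hs).mul hg.continuousOn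
  have hterm : ∀ k ∈ Finset.range (n + 1), ∫ x in (0:ℝ)..1,
      (-1 : ℝ) ^ k * (iteratedDerivWithin (2 * k) f (Icc (0:ℝ) 1) x * g x) = _ := fun k hk =>
    (intervalIntegral.integral_const_mul _ _).trans
      (integral_iteratedDerivWithin_two_mul_mul zero_lt_one hf hg
        (Finset.mem_range_succ_iff.mp hk) le_rfl)
  simp only [opA, Finset.sum_mul, mul_assoc]
  rw [intervalIntegral.integral_finsetSum hint, Finset.sum_congr rfl hterm,
    Finset.sum_add_distrib]
  congr 1
  · refine Finset.sum_congr rfl fun k _ => ?_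
    rw [Even.neg_one_pow ⟨k, rfl⟩, one_mul, show 2 * k - k = k by omega]
  · rw [Finset.sum_comm' (t' := Finset.range n) (s' := fun i => Finset.Icc (i + 1) n)
      (by intro k i; simp only [Finset.mem_range, Finset.mem_Icc]; omega)]
    refine Finset.sum_congr rfl fun i _ => ?_
    simp only [opB, Finset.sum_mul, ← Finset.sum_sub_distrib]
    exact Finset.sum_congr rfl fun k _ => by ring
end

section
/- Let n ≥ 1 be an integer and f, g, w ∈ C^{2n}([0,1]). Then the following identity holds: ∫₀¹ w (Aₙf) g' dx + ∫₀¹ (wf)' (Aₙg) dx + ∫₀¹ Σ_{i=0}^{n} ( (w f^{(i)})'(x) − ((wf)')^{(i)}(x) ) g^{(i)}(x) dx − ∫₀¹ Σ_{i=0}^{n} f^{(i)}(x) ( (w g')^{(i)}(x) − w(x) g^{(i+1)}(x) ) dx = Σ_{i=0}^{n−1} [ Bᵢ(g) ((wf)')^{(i)} ]₀¹ + Σ_{i=0}^{n−1} [ Bᵢ(f) (w g')^{(i)} ]₀¹ + [ w Σ_{i=0}^{n} f^{(i)} g^{(i)} ]₀¹. -/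
open Set

/-- Iterated derivatives within `[0,1]` of a `C^N` function are `C^m` when `m + i ≤ N`. -/
theorem contDiffOn_iteratedDerivWithin_Icc {f : ℝ → ℝ} {N m i : ℕ}
    (hf : ContDiffOn ℝ N f (Icc (0:ℝ) 1)) (h : m + i ≤ N) :
    ContDiffOn ℝ m (iteratedDerivWithin i f (Icc (0:ℝ) 1)) (Icc (0:ℝ) 1) := by
  induction i generalizing m with
  | zero =>
    rw [iteratedDerivWithin_zero]
    exact hf.of_le (by exact_mod_cast h)
  | succ i ih =>
    rw [iteratedDerivWithin_succ]
    exact (ih (m := m + 1) (by omega)).derivWithin (uniqueDiffOn_Icc zero_lt_one)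
      (by push_cast; exact le_rfl)

theorem continuousOn_iteratedDerivWithin_Icc {f : ℝ → ℝ} {N i : ℕ}
    (hf : ContDiffOn ℝ N f (Icc (0:ℝ) 1)) (h : i ≤ N) :
    ContinuousOn (iteratedDerivWithin i f (Icc (0:ℝ) 1)) (Icc (0:ℝ) 1) :=
  (contDiffOn_iteratedDerivWithin_Icc (m := 0) hf (by omega)).continuousOn

theorem intervalIntegrable_of_continuousOn_Icc {u : ℝ → ℝ} (hu : ContinuousOn u (Icc (0:ℝ) 1)) :
    IntervalIntegrable u MeasureTheory.volume 0 1 :=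
  hu.intervalIntegrable_of_Icc zero_le_one

/-- Integration by parts on `[0,1]` with one-sided derivatives at the endpoints. -/
theorem integral_derivWithin_mul_add {u v : ℝ → ℝ}
    (hu : ContDiffOn ℝ 1 u (Icc (0:ℝ) 1)) (hv : ContDiffOn ℝ 1 v (Icc (0:ℝ) 1)) :
    (∫ x in (0:ℝ)..1, derivWithin u (Icc (0:ℝ) 1) x * v x + u x * derivWithin v (Icc (0:ℝ) 1) x)
      = u 1 * v 1 - u 0 * v 0 := by
  have hs : UniqueDiffOn ℝ (Icc (0:ℝ) 1) := uniqueDiffOn_Icc zero_lt_one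
  have key : ∀ {h : ℝ → ℝ}, ContDiffOn ℝ 1 h (Icc (0:ℝ) 1) → ∀ x ∈ Ioo (0:ℝ) 1,
      HasDerivAt h (derivWithin h (Icc (0:ℝ) 1) x) x := fun hh x hx =>
    ((hh.differentiableOn one_ne_zero x (Ioo_subset_Icc_self hx)).hasDerivWithinAt).hasDerivAt
      (Icc_mem_nhds hx.1 hx.2)
  refine intervalIntegral.integral_eq_sub_of_hasDerivAt_of_le (f := fun x => u x * v x)
    zero_le_one (hu.continuousOn.mul hv.continuousOn)
    (fun x hx => (key hu x hx).mul (key hv x hx)) ?_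
  exact intervalIntegrable_of_continuousOn_Icc
    (((hu.continuousOn_derivWithin hs le_rfl).mul hv.continuousOn).add
      (hu.continuousOn.mul (hv.continuousOn_derivWithin hs le_rfl)))

/-- Repeated integration by parts, moving `k` derivatives from `f` to `φ`. -/
theorem integral_iteratedDerivWithin_mul {f φ : ℝ → ℝ} {N M : ℕ}
    (hf : ContDiffOn ℝ N f (Icc (0:ℝ) 1)) (hφ : ContDiffOn ℝ M φ (Icc (0:ℝ) 1))
    (k : ℕ) (hkN : k ≤ N) (hkM : k ≤ M) :
    (∫ x in (0:ℝ)..1, iteratedDerivWithin N f (Icc (0:ℝ) 1) x * φ x)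
      = (∑ j ∈ Finset.range k, (-1 : ℝ) ^ j *
          (iteratedDerivWithin (N - 1 - j) f (Icc (0:ℝ) 1) 1
              * iteratedDerivWithin j φ (Icc (0:ℝ) 1) 1
            - iteratedDerivWithin (N - 1 - j) f (Icc (0:ℝ) 1) 0
              * iteratedDerivWithin j φ (Icc (0:ℝ) 1) 0))
        + (-1 : ℝ) ^ k * ∫ x in (0:ℝ)..1, iteratedDerivWithin (N - k) f (Icc (0:ℝ) 1) x
            * iteratedDerivWithin k φ (Icc (0:ℝ) 1) x := by
  induction k with
  | zero => simp
  | succ k ih =>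
    rw [ih (by omega) (by omega), Finset.sum_range_succ]
    have hN : N - k = (N - 1 - k) + 1 := by omega
    have hN' : N - (k + 1) = N - 1 - k := by omega
    have hp := integral_derivWithin_mul_add
      (contDiffOn_iteratedDerivWithin_Icc (m := 1) (i := N - 1 - k) hf (by omega))
      (contDiffOn_iteratedDerivWithin_Icc (m := 1) (i := k) hφ (by omega))
    simp only [← iteratedDerivWithin_succ, ← hN] at hp
    have hint : ∀ i ≤ N, ∀ j ≤ M, IntervalIntegrable
        (fun x => iteratedDerivWithin i f (Icc (0:ℝ) 1) x
          * iteratedDerivWithin j φ (Icc (0:ℝ) 1) x) MeasureTheory.volume 0 1 :=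
      fun i hi j hj => intervalIntegrable_of_continuousOn_Icc
        ((continuousOn_iteratedDerivWithin_Icc hf hi).mul
          (continuousOn_iteratedDerivWithin_Icc hφ hj))
    rw [intervalIntegral.integral_add (hint _ (by omega) _ (by omega))
      (hint _ (by omega) _ (by omega))] at hp
    rw [hN', ← hp, pow_succ]
    ring

/-- Green's formula for `opA`: integrating against `φ` produces the boundary operators `opB`. -/
theorem integral_opA_mul {f φ : ℝ → ℝ} {n : ℕ}
    (hf : ContDiffOn ℝ (2 * n : ℕ) f (Icc (0:ℝ) 1)) (hφ : ContDiffOn ℝ n φ (Icc (0:ℝ) 1)) :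
    (∫ x in (0:ℝ)..1, opA n f x * φ x)
      = (∑ i ∈ Finset.range n,
          (opB n i f 1 * iteratedDerivWithin i φ (Icc (0:ℝ) 1) 1
            - opB n i f 0 * iteratedDerivWithin i φ (Icc (0:ℝ) 1) 0))
        + ∫ x in (0:ℝ)..1, ∑ i ∈ Finset.range (n + 1),
            iteratedDerivWithin i f (Icc (0:ℝ) 1) x * iteratedDerivWithin i φ (Icc (0:ℝ) 1) x := by
  have hterm : ∀ k ∈ Finset.range (n + 1),
      (∫ x in (0:ℝ)..1, (-1 : ℝ) ^ k * iteratedDerivWithin (2 * k) f (Icc (0:ℝ) 1) x * φ x)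
        = (∑ i ∈ Finset.range k, (-1 : ℝ) ^ (k + i) *
            (iteratedDerivWithin (2 * k - 1 - i) f (Icc (0:ℝ) 1) 1
                * iteratedDerivWithin i φ (Icc (0:ℝ) 1) 1
              - iteratedDerivWithin (2 * k - 1 - i) f (Icc (0:ℝ) 1) 0
                * iteratedDerivWithin i φ (Icc (0:ℝ) 1) 0))
          + ∫ x in (0:ℝ)..1, iteratedDerivWithin k f (Icc (0:ℝ) 1) x
              * iteratedDerivWithin k φ (Icc (0:ℝ) 1) x := by
    intro k hk
    have hkn : k ≤ n := Nat.lt_succ_iff.mp (Finset.mem_range.mp hk)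
    have hfk : ContDiffOn ℝ (2 * k : ℕ) f (Icc (0:ℝ) 1) :=
      hf.of_le (by exact_mod_cast (by omega : 2 * k ≤ 2 * n))
    simp only [mul_assoc, intervalIntegral.integral_const_mul]
    rw [integral_iteratedDerivWithin_mul hfk hφ k (by omega) hkn, mul_add, ← mul_assoc,
      ← mul_pow, Finset.mul_sum, show 2 * k - k = k by omega]
    simp only [pow_add, mul_assoc]
    norm_num
  have hint : ∀ k ∈ Finset.range (n + 1), IntervalIntegrable
      (fun x => (-1 : ℝ) ^ k * iteratedDerivWithin (2 * k) f (Icc (0:ℝ) 1) x * φ x)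
      MeasureTheory.volume 0 1 := by
    intro k hk
    have hkn : k ≤ n := Nat.lt_succ_iff.mp (Finset.mem_range.mp hk)
    exact intervalIntegrable_of_continuousOn_Icc ((continuousOn_const.mul
      (continuousOn_iteratedDerivWithin_Icc hf (by omega))).mul hφ.continuousOn)
  have hint' : ∀ k ∈ Finset.range (n + 1), IntervalIntegrable
      (fun x => iteratedDerivWithin k f (Icc (0:ℝ) 1) x
        * iteratedDerivWithin k φ (Icc (0:ℝ) 1) x) MeasureTheory.volume 0 1 := by
    intro k hk
    have hkn : k ≤ n := Nat.lt_succ_iff.mp (Finset.mem_range.mp hk)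
    exact intervalIntegrable_of_continuousOn_Icc
      ((continuousOn_iteratedDerivWithin_Icc hf (by omega)).mul
        (continuousOn_iteratedDerivWithin_Icc hφ hkn))
  simp only [opA, opB, Finset.sum_mul]
  rw [intervalIntegral.integral_finsetSum hint, intervalIntegral.integral_finsetSum hint',
    Finset.sum_congr rfl hterm, Finset.sum_add_distrib]
  congr 1
  simp only [← Finset.sum_sub_distrib]
  rw [Finset.sum_comm' (t' := Finset.range n) (s' := fun i => Finset.Icc (i + 1) n)
    (by intro k i; simp only [Finset.mem_range, Finset.mem_Icc]; omega)]
  refine Finset.sum_congr rfl fun i _ => Finset.sum_congr rfl fun k _ => ?_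
  ring

/-- **Weighted double integration-by-parts identity for `Aₙ` (Lemma A.3).**
For `n ≥ 1` and `f, g, w ∈ C^{2n}([0,1])`:
`∫₀¹ w (Aₙf) g' + ∫₀¹ (wf)' (Aₙg)
  + ∫₀¹ Σ_{i≤n} ((w f^{(i)})' − ((wf)')^{(i)}) g^{(i)}
  − ∫₀¹ Σ_{i≤n} f^{(i)} ((w g')^{(i)} − w g^{(i+1)})
 = Σ_{i<n} [Bᵢ(g) ((wf)')^{(i)}]₀¹ + Σ_{i<n} [Bᵢ(f) (w g')^{(i)}]₀¹
  + [w Σ_{i≤n} f^{(i)} g^{(i)}]₀¹`. -/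
theorem opA_weighted_commutator_identity
    (n : ℕ) (hn : 1 ≤ n) (f g w : ℝ → ℝ)
    (hf : ContDiffOn ℝ (2 * n : ℕ) f (Icc (0:ℝ) 1))
    (hg : ContDiffOn ℝ (2 * n : ℕ) g (Icc (0:ℝ) 1))
    (hw : ContDiffOn ℝ (2 * n : ℕ) w (Icc (0:ℝ) 1)) :
    (∫ x in (0:ℝ)..1, w x * opA n f x * derivWithin g (Icc (0:ℝ) 1) x)
    + (∫ x in (0:ℝ)..1, derivWithin (fun y => w y * f y) (Icc (0:ℝ) 1) x * opA n g x)
    + (∫ x in (0:ℝ)..1, ∑ i ∈ Finset.range (n + 1),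
        (derivWithin (fun y => w y * iteratedDerivWithin i f (Icc (0:ℝ) 1) y) (Icc (0:ℝ) 1) x
          - iteratedDerivWithin i
              (derivWithin (fun y => w y * f y) (Icc (0:ℝ) 1)) (Icc (0:ℝ) 1) x)
          * iteratedDerivWithin i g (Icc (0:ℝ) 1) x)
    - (∫ x in (0:ℝ)..1, ∑ i ∈ Finset.range (n + 1),
        iteratedDerivWithin i f (Icc (0:ℝ) 1) x
          * (iteratedDerivWithin i
                (fun y => w y * derivWithin g (Icc (0:ℝ) 1) y) (Icc (0:ℝ) 1) x
              - w x * iteratedDerivWithin (i + 1) g (Icc (0:ℝ) 1) x))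
    = (∑ i ∈ Finset.range n,
        (opB n i g 1 * iteratedDerivWithin i
            (derivWithin (fun y => w y * f y) (Icc (0:ℝ) 1)) (Icc (0:ℝ) 1) 1
          - opB n i g 0 * iteratedDerivWithin i
              (derivWithin (fun y => w y * f y) (Icc (0:ℝ) 1)) (Icc (0:ℝ) 1) 0))
      + (∑ i ∈ Finset.range n,
          (opB n i f 1 * iteratedDerivWithin i
              (fun y => w y * derivWithin g (Icc (0:ℝ) 1) y) (Icc (0:ℝ) 1) 1
            - opB n i f 0 * iteratedDerivWithin i
                (fun y => w y * derivWithin g (Icc (0:ℝ) 1) y) (Icc (0:ℝ) 1) 0))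
      + (w 1 * (∑ i ∈ Finset.range (n + 1),
            iteratedDerivWithin i f (Icc (0:ℝ) 1) 1 * iteratedDerivWithin i g (Icc (0:ℝ) 1) 1)
        - w 0 * ∑ i ∈ Finset.range (n + 1),
            iteratedDerivWithin i f (Icc (0:ℝ) 1) 0
              * iteratedDerivWithin i g (Icc (0:ℝ) 1) 0) := by
  have hs : UniqueDiffOn ℝ (Icc (0:ℝ) 1) := uniqueDiffOn_Icc zero_lt_one
  have hwf : ContDiffOn ℝ n (derivWithin (fun y => w y * f y) (Icc (0:ℝ) 1)) (Icc (0:ℝ) 1) :=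
    (hw.mul hf).derivWithin hs (by exact_mod_cast (by omega : n + 1 ≤ 2 * n))
  have hg' : ContDiffOn ℝ n (derivWithin g (Icc (0:ℝ) 1)) (Icc (0:ℝ) 1) :=
    hg.derivWithin hs (by exact_mod_cast (by omega : n + 1 ≤ 2 * n))
  have hwg : ContDiffOn ℝ n (fun y => w y * derivWithin g (Icc (0:ℝ) 1) y) (Icc (0:ℝ) 1) :=
    (hw.of_le (by exact_mod_cast (by omega : n ≤ 2 * n))).mul hg'
  have hw1 : ContDiffOn ℝ 1 w (Icc (0:ℝ) 1) :=
    hw.of_le (by exact_mod_cast (by omega : 1 ≤ 2 * n))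
  have hf1 : ∀ i ∈ Finset.range (n + 1),
      ContDiffOn ℝ 1 (iteratedDerivWithin i f (Icc (0:ℝ) 1)) (Icc (0:ℝ) 1) := fun i hi =>
    contDiffOn_iteratedDerivWithin_Icc (m := 1) hf (by have := Finset.mem_range.mp hi; omega)
  have hg1 : ∀ i ∈ Finset.range (n + 1),
      ContDiffOn ℝ 1 (iteratedDerivWithin i g (Icc (0:ℝ) 1)) (Icc (0:ℝ) 1) := fun i hi =>
    contDiffOn_iteratedDerivWithin_Icc (m := 1) hg (by have := Finset.mem_range.mp hi; omega)
  have hgs : ∀ i ∈ Finset.range (n + 1),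
      ContinuousOn (iteratedDerivWithin (i + 1) g (Icc (0:ℝ) 1)) (Icc (0:ℝ) 1) := fun i hi =>
    continuousOn_iteratedDerivWithin_Icc hg (by have := Finset.mem_range.mp hi; omega)
  have hwfi : ∀ i ∈ Finset.range (n + 1), ContinuousOn (iteratedDerivWithin i
      (derivWithin (fun y => w y * f y) (Icc (0:ℝ) 1)) (Icc (0:ℝ) 1)) (Icc (0:ℝ) 1) :=
    fun i hi => continuousOn_iteratedDerivWithin_Icc hwf
      (by have := Finset.mem_range.mp hi; omega)
  have hwgi : ∀ i ∈ Finset.range (n + 1), ContinuousOn (iteratedDerivWithin i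
      (fun y => w y * derivWithin g (Icc (0:ℝ) 1) y) (Icc (0:ℝ) 1)) (Icc (0:ℝ) 1) :=
    fun i hi => continuousOn_iteratedDerivWithin_Icc hwg
      (by have := Finset.mem_range.mp hi; omega)
  have hdi : ∀ i ∈ Finset.range (n + 1), ContinuousOn (derivWithin
      (fun y => w y * iteratedDerivWithin i f (Icc (0:ℝ) 1) y) (Icc (0:ℝ) 1)) (Icc (0:ℝ) 1) :=
    fun i hi => (hw1.mul (hf1 i hi)).continuousOn_derivWithin hs le_rfl
  have hA : (∫ x in (0:ℝ)..1, w x * opA n f x * derivWithin g (Icc (0:ℝ) 1) x)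
      = ∫ x in (0:ℝ)..1, opA n f x * (w x * derivWithin g (Icc (0:ℝ) 1) x) := by
    congr 1; ext x; ring
  have hB : (∫ x in (0:ℝ)..1, derivWithin (fun y => w y * f y) (Icc (0:ℝ) 1) x * opA n g x)
      = ∫ x in (0:ℝ)..1, opA n g x * derivWithin (fun y => w y * f y) (Icc (0:ℝ) 1) x := by
    congr 1; ext x; ring
  have hC : (∫ x in (0:ℝ)..1, ∑ i ∈ Finset.range (n + 1),
      (derivWithin (fun y => w y * iteratedDerivWithin i f (Icc (0:ℝ) 1) y) (Icc (0:ℝ) 1) x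
          * iteratedDerivWithin i g (Icc (0:ℝ) 1) x
        + w x * iteratedDerivWithin i f (Icc (0:ℝ) 1) x
          * iteratedDerivWithin (i + 1) g (Icc (0:ℝ) 1) x))
      = w 1 * (∑ i ∈ Finset.range (n + 1),
            iteratedDerivWithin i f (Icc (0:ℝ) 1) 1 * iteratedDerivWithin i g (Icc (0:ℝ) 1) 1)
        - w 0 * ∑ i ∈ Finset.range (n + 1),
            iteratedDerivWithin i f (Icc (0:ℝ) 1) 0
              * iteratedDerivWithin i g (Icc (0:ℝ) 1) 0 := by
    have hint : ∀ i ∈ Finset.range (n + 1), IntervalIntegrable (fun x =>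
        derivWithin (fun y => w y * iteratedDerivWithin i f (Icc (0:ℝ) 1) y) (Icc (0:ℝ) 1) x
            * iteratedDerivWithin i g (Icc (0:ℝ) 1) x
          + w x * iteratedDerivWithin i f (Icc (0:ℝ) 1) x
            * iteratedDerivWithin (i + 1) g (Icc (0:ℝ) 1) x) MeasureTheory.volume 0 1 :=
      fun i hi => intervalIntegrable_of_continuousOn_Icc
        (((hdi i hi).mul (hg1 i hi).continuousOn).add
          ((hw1.continuousOn.mul (hf1 i hi).continuousOn).mul (hgs i hi)))
    rw [intervalIntegral.integral_finsetSum hint,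
      Finset.mul_sum, Finset.mul_sum, ← Finset.sum_sub_distrib]
    refine Finset.sum_congr rfl fun i hi => ?_
    simp only [iteratedDerivWithin_succ (n := i), ← mul_assoc]
    exact integral_derivWithin_mul_add (hw1.mul (hf1 i hi)) (hg1 i hi)
  have iF := intervalIntegrable_of_continuousOn_Icc (continuousOn_finsetSum _ fun i hi =>
    (hf1 i hi).continuousOn.mul (hwgi i hi))
  have iG := intervalIntegrable_of_continuousOn_Icc (continuousOn_finsetSum _ fun i hi =>
    (hg1 i hi).continuousOn.mul (hwfi i hi))
  have iC := intervalIntegrable_of_continuousOn_Icc (continuousOn_finsetSum _ fun i hi =>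
    ((hdi i hi).sub (hwfi i hi)).mul (hg1 i hi).continuousOn)
  have iD := intervalIntegrable_of_continuousOn_Icc (continuousOn_finsetSum _ fun i hi =>
    (hf1 i hi).continuousOn.mul ((hwgi i hi).sub (hw1.continuousOn.mul (hgs i hi))))
  have hsum := intervalIntegral.integral_sub ((iF.add iG).add iC) iD
  rw [intervalIntegral.integral_add (iF.add iG) iC, intervalIntegral.integral_add iF iG] at hsum
  rw [hA, hB, integral_opA_mul hf hwg, integral_opA_mul hg hwf, ← hC]
  simp only [Pi.mul_apply, Pi.sub_apply, ← Finset.sum_add_distrib,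
    ← Finset.sum_sub_distrib] at hsum
  have hpt : ∀ a b c d e p q : ℝ,
      a * b + c * d + (e - d) * c - a * (b - p * q) = e * c + p * a * q :=
    fun a b c d e p q => by ring
  simp only [hpt] at hsum
  linarith
end

section
/- For every integer n ≥ 1 there exists a constant C > 0, depending only on n, such that for every u ∈ C^{2n}([0,1]) satisfying (Aₙu)(x) = 0 for all x ∈ [0,1] and u^{(i)}(1) = 0 for every 0 ≤ i ≤ n−1, one has |u^{(n)}(1)|² ≤ C Σ_{i=0}^{n} ∫₀¹ |u^{(i)}(x)|² dx. -/
open Set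

open Polynomial in
/-- Iterated integration by parts on `[0,1]` against a polynomial. -/
theorem integral_iteratedDerivWithin_mul_eval {u : ℝ → ℝ} {N : ℕ}
    (hu : ContDiffOn ℝ N u (Icc (0:ℝ) 1)) (m : ℕ) (hm : m ≤ N) (p : ℝ[X]) :
    ∫ x in (0:ℝ)..1, iteratedDerivWithin m u (Icc (0:ℝ) 1) x * p.eval x =
      ∑ j ∈ Finset.range m, (-1 : ℝ) ^ j *
        (iteratedDerivWithin (m - 1 - j) u (Icc (0:ℝ) 1) 1 * (derivative^[j] p).eval 1 -
          iteratedDerivWithin (m - 1 - j) u (Icc (0:ℝ) 1) 0 * (derivative^[j] p).eval 0) +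
      (-1) ^ m * ∫ x in (0:ℝ)..1, u x * (derivative^[m] p).eval x := by
  have hI : uIcc (0:ℝ) 1 = Icc 0 1 := uIcc_of_le zero_le_one
  have hs : UniqueDiffOn ℝ (Icc (0:ℝ) 1) := uniqueDiffOn_Icc zero_lt_one
  induction m generalizing p with
  | zero => simp [iteratedDerivWithin_zero]
  | succ m ih =>
    have hcont := hu.continuousOn_iteratedDerivWithin (m := m + 1) (by exact_mod_cast hm) hs
    have hderiv : ∀ x ∈ uIcc (0:ℝ) 1, HasDerivWithinAt (iteratedDerivWithin m u (Icc (0:ℝ) 1))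
        (iteratedDerivWithin (m + 1) u (Icc (0:ℝ) 1) x) (uIcc (0:ℝ) 1) x := by
      intro x hx
      rw [hI] at hx ⊢
      rw [iteratedDerivWithin_succ]
      exact (hu.differentiableOn_iteratedDerivWithin (by exact_mod_cast hm) hs x hx).hasDerivWithinAt
    have key := intervalIntegral.integral_mul_deriv_eq_deriv_mul_of_hasDerivWithinAt
      hderiv (fun x _ => (p.hasDerivAt x).hasDerivWithinAt)
      (ContinuousOn.intervalIntegrable (by rwa [hI]))
      (p.derivative.continuous.intervalIntegrable 0 1)
    have ih' := ih (by omega) (derivative p)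
    rw [key] at ih'
    rw [Finset.sum_range_succ']
    have hsum : ∑ j ∈ Finset.range m, (-1 : ℝ) ^ (j + 1) *
        (iteratedDerivWithin (m + 1 - 1 - (j + 1)) u (Icc (0:ℝ) 1) 1 *
            (derivative^[j + 1] p).eval 1 -
          iteratedDerivWithin (m + 1 - 1 - (j + 1)) u (Icc (0:ℝ) 1) 0 *
            (derivative^[j + 1] p).eval 0) =
        -∑ j ∈ Finset.range m, (-1 : ℝ) ^ j *
          (iteratedDerivWithin (m - 1 - j) u (Icc (0:ℝ) 1) 1 *
              (derivative^[j] (derivative p)).eval 1 -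
            iteratedDerivWithin (m - 1 - j) u (Icc (0:ℝ) 1) 0 *
              (derivative^[j] (derivative p)).eval 0) := by
      rw [← Finset.sum_neg_distrib]
      refine Finset.sum_congr rfl fun j _ => ?_
      rw [show m + 1 - 1 - (j + 1) = m - 1 - j by omega, Function.iterate_succ_apply]
      ring
    rw [hsum, Function.iterate_succ_apply]
    simp only [add_tsub_cancel_right, tsub_zero, Function.iterate_zero, id_eq, pow_zero, one_mul]
    rw [pow_succ]
    linarith

open Polynomial in
theorem eval_iterate_derivative_eq_zero_of_pow_dvd {p : ℝ[X]} {r : ℝ} {k j : ℕ}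
    (h : (X - C r) ^ k ∣ p) (hj : j < k) : (derivative^[j] p).eval r = 0 := by
  have h' := (dvd_pow_self (X - C r) (Nat.sub_ne_zero_of_lt hj)).trans
    (pow_sub_dvd_iterate_derivative_of_pow_dvd j h)
  exact dvd_iff_isRoot.mp h'

theorem sq_integral_mul_le {f g : ℝ → ℝ} (hf : ContinuousOn f (Icc (0:ℝ) 1))
    (hg : ContinuousOn g (Icc (0:ℝ) 1)) :
    (∫ x in (0:ℝ)..1, f x * g x) ^ 2 ≤
      ((∫ x in (0:ℝ)..1, g x ^ 2) + 1) * ∫ x in (0:ℝ)..1, f x ^ 2 := by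
  have hI : uIcc (0:ℝ) 1 = Icc 0 1 := uIcc_of_le zero_le_one
  rw [← hI] at hf hg
  set I := ∫ x in (0:ℝ)..1, f x * g x
  set P := ∫ x in (0:ℝ)..1, g x ^ 2
  set U := ∫ x in (0:ℝ)..1, f x ^ 2
  have hP : 0 ≤ P := intervalIntegral.integral_nonneg zero_le_one fun x _ => sq_nonneg _
  have hexp : ∫ x in (0:ℝ)..1, ((P + 1) * f x - I * g x) ^ 2 =
      (P + 1) ^ 2 * U - 2 * (P + 1) * I * I + I ^ 2 * P := by
    have h1 : IntervalIntegrable (fun x => (P + 1) ^ 2 * f x ^ 2) MeasureTheory.volume 0 1 :=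
      (continuousOn_const.mul (hf.pow 2)).intervalIntegrable
    have h2 : IntervalIntegrable (fun x => 2 * (P + 1) * I * (f x * g x))
        MeasureTheory.volume 0 1 :=
      (continuousOn_const.mul (hf.mul hg)).intervalIntegrable
    have h3 : IntervalIntegrable (fun x => I ^ 2 * g x ^ 2) MeasureTheory.volume 0 1 :=
      (continuousOn_const.mul (hg.pow 2)).intervalIntegrable
    calc ∫ x in (0:ℝ)..1, ((P + 1) * f x - I * g x) ^ 2
        = ∫ x in (0:ℝ)..1, ((P + 1) ^ 2 * f x ^ 2 - 2 * (P + 1) * I * (f x * g x) +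
            I ^ 2 * g x ^ 2) := intervalIntegral.integral_congr fun x _ => by ring
      _ = _ := by
        rw [intervalIntegral.integral_add (h1.sub h2) h3, intervalIntegral.integral_sub h1 h2]
        simp only [intervalIntegral.integral_const_mul, I, P, U]
  have hnn : 0 ≤ ∫ x in (0:ℝ)..1, ((P + 1) * f x - I * g x) ^ 2 :=
    intervalIntegral.integral_nonneg zero_le_one fun x _ => sq_nonneg _
  rw [hexp] at hnn
  have hmul : (P + 1) * I ^ 2 ≤ (P + 1) * ((P + 1) * U) := by nlinarith [sq_nonneg I]
  exact le_of_mul_le_mul_left hmul (by linarith)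

open Polynomial in
/-- **Rellich-type boundary estimate (Proposition 3.7).**
For every `n ≥ 1` there is a constant `C > 0` depending only on `n` such that any
`u ∈ C^{2n}([0,1])` with `Aₙu = 0` on `[0,1]` and `u^{(i)}(1) = 0` for `0 ≤ i ≤ n−1`
satisfies `|u^{(n)}(1)|² ≤ C Σ_{i=0}^{n} ∫₀¹ |u^{(i)}|²  (= C ‖u‖²_{Hⁿ})`. -/
theorem opA_rellich_estimate (n : ℕ) (hn : 1 ≤ n) :
    ∃ C > (0:ℝ), ∀ u : ℝ → ℝ, ContDiffOn ℝ (2 * n : ℕ) u (Icc (0:ℝ) 1) →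
      (∀ x ∈ Icc (0:ℝ) 1, opA n u x = 0) →
      (∀ i ≤ n - 1, iteratedDerivWithin i u (Icc (0:ℝ) 1) 1 = 0) →
      (iteratedDerivWithin n u (Icc (0:ℝ) 1) 1) ^ 2
        ≤ C * ∑ i ∈ Finset.range (n + 1),
            ∫ x in (0:ℝ)..1, (iteratedDerivWithin i u (Icc (0:ℝ) 1) x) ^ 2 := by
  obtain ⟨m, rfl⟩ : ∃ m, n = m + 1 := ⟨n - 1, by omega⟩
  set φ : ℝ[X] := (X - C 1) ^ m * X ^ (2 * (m + 1)) with hφ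
  set ψ : ℝ[X] := ∑ k ∈ Finset.range (m + 1 + 1), (-1 : ℝ[X]) ^ k * derivative^[2 * k] φ with hψ
  have hφ0 : ∀ j < 2 * (m + 1), (derivative^[j] φ).eval 0 = 0 := fun j hj =>
    eval_iterate_derivative_eq_zero_of_pow_dvd
      (by rw [C_0, sub_zero]; exact dvd_mul_left _ _) hj
  have hφ1 : ∀ j < m, (derivative^[j] φ).eval 1 = 0 := fun j hj =>
    eval_iterate_derivative_eq_zero_of_pow_dvd (dvd_mul_right _ _) hj
  have hφm : (derivative^[m] φ).eval 1 = (m.factorial : ℝ) := by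
    have := aeval_iterate_derivative_self φ m (1 : ℝ) (p' := X ^ (2 * (m + 1))) (by simp [hφ])
    simpa using this
  have hP : 0 ≤ ∫ x in (0:ℝ)..1, ψ.eval x ^ 2 :=
    intervalIntegral.integral_nonneg zero_le_one fun x _ => sq_nonneg _
  refine ⟨(∫ x in (0:ℝ)..1, ψ.eval x ^ 2) + 1, by linarith, fun u hu hA hbd => ?_⟩
  have hs : UniqueDiffOn ℝ (Icc (0:ℝ) 1) := uniqueDiffOn_Icc zero_lt_one
  have hI : uIcc (0:ℝ) 1 = Icc 0 1 := uIcc_of_le zero_le_one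
  have hparts : ∀ k ≤ m + 1,
      ∫ x in (0:ℝ)..1, iteratedDerivWithin (2 * k) u (Icc (0:ℝ) 1) x * φ.eval x =
      (if k = m + 1 then
        (-1) ^ m * (iteratedDerivWithin (m + 1) u (Icc (0:ℝ) 1) 1 * m.factorial) else 0) +
      ∫ x in (0:ℝ)..1, u x * (derivative^[2 * k] φ).eval x := by
    intro k hk
    rw [integral_iteratedDerivWithin_mul_eval hu (2 * k) (by omega) φ, pow_mul]
    simp only [even_two, Even.neg_pow, one_pow, one_mul]
    congr 1
    have hterm : ∀ j ∈ Finset.range (2 * k), ¬ (k = m + 1 ∧ j = m) → (-1 : ℝ) ^ j *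
        (iteratedDerivWithin (2 * k - 1 - j) u (Icc (0:ℝ) 1) 1 * (derivative^[j] φ).eval 1 -
          iteratedDerivWithin (2 * k - 1 - j) u (Icc (0:ℝ) 1) 0 *
            (derivative^[j] φ).eval 0) = 0 := by
      intro j hj hne
      rw [Finset.mem_range] at hj
      rw [hφ0 j (by omega)]
      rcases lt_or_ge j m with h | h
      · simp [hφ1 j h]
      · simp [hbd (2 * k - 1 - j) (by omega)]
    split_ifs with hkm
    · subst hkm
      rw [Finset.sum_eq_single_of_mem m (by simp; omega)
        fun j hj hne => hterm j hj fun h => hne h.2]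
      rw [hφ0 m (by omega), hφm, show 2 * (m + 1) - 1 - m = m + 1 by omega, mul_zero, sub_zero]
    · exact Finset.sum_eq_zero fun j hj => hterm j hj fun h => hkm h.1
  have hsum : ∑ k ∈ Finset.range (m + 1 + 1), (-1 : ℝ) ^ k *
      ∫ x in (0:ℝ)..1, iteratedDerivWithin (2 * k) u (Icc (0:ℝ) 1) x * φ.eval x = 0 := by
    simp_rw [← intervalIntegral.integral_const_mul]
    rw [← intervalIntegral.integral_finsetSum]
    · rw [intervalIntegral.integral_congr (g := fun _ => (0:ℝ)), intervalIntegral.integral_zero]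
      intro x hx
      rw [hI] at hx
      simp only [← mul_assoc, ← Finset.sum_mul]
      rw [← opA, hA x hx, zero_mul]
    · intro k hk
      rw [Finset.mem_range] at hk
      refine ContinuousOn.intervalIntegrable ?_
      rw [hI]
      exact continuousOn_const.mul ((hu.continuousOn_iteratedDerivWithin
        (by exact_mod_cast (by omega : 2 * k ≤ 2 * (m + 1))) hs).mul φ.continuous.continuousOn)
  have hψint : ∑ k ∈ Finset.range (m + 1 + 1), (-1 : ℝ) ^ k *
      ∫ x in (0:ℝ)..1, u x * (derivative^[2 * k] φ).eval x = ∫ x in (0:ℝ)..1, u x * ψ.eval x := by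
    simp_rw [← intervalIntegral.integral_const_mul]
    rw [← intervalIntegral.integral_finsetSum]
    · refine intervalIntegral.integral_congr fun x _ => ?_
      simp only [hψ, eval_finsetSum, Finset.mul_sum, eval_mul, eval_pow, eval_neg, eval_one]
      exact Finset.sum_congr rfl fun k _ => by ring
    · intro k _
      refine ContinuousOn.intervalIntegrable ?_
      rw [hI]
      exact continuousOn_const.mul (hu.continuousOn.mul (Polynomial.continuous _).continuousOn)
  have hrep : iteratedDerivWithin (m + 1) u (Icc (0:ℝ) 1) 1 * m.factorial =
      ∫ x in (0:ℝ)..1, u x * ψ.eval x := by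
    rw [Finset.sum_congr rfl fun k hk => by
      rw [hparts k (by rw [Finset.mem_range] at hk; omega), mul_add]] at hsum
    rw [Finset.sum_add_distrib, hψint] at hsum
    simp only [mul_ite, mul_zero, Finset.sum_ite_eq', Finset.mem_range, lt_add_iff_pos_right,
      zero_lt_one, if_true] at hsum
    have hsign : (-1 : ℝ) ^ m * (-1) ^ m = 1 := by rw [← mul_pow]; norm_num
    rw [pow_succ] at hsum
    linear_combination (iteratedDerivWithin (m + 1) u (Icc (0:ℝ) 1) 1 * m.factorial) *
      (-hsign) - hsum
  have hfac : (1:ℝ) ≤ (m.factorial : ℝ) ^ 2 :=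
    one_le_pow₀ (by exact_mod_cast Nat.succ_le_of_lt m.factorial_pos)
  have hle : ∫ x in (0:ℝ)..1, u x ^ 2 ≤ ∑ i ∈ Finset.range (m + 1 + 1),
      ∫ x in (0:ℝ)..1, (iteratedDerivWithin i u (Icc (0:ℝ) 1) x) ^ 2 := by
    have := Finset.single_le_sum (s := Finset.range (m + 1 + 1))
      (f := fun i => ∫ x in (0:ℝ)..1, (iteratedDerivWithin i u (Icc (0:ℝ) 1) x) ^ 2)
      (fun i _ => intervalIntegral.integral_nonneg zero_le_one fun x _ => sq_nonneg _)
      (Finset.mem_range.mpr (Nat.succ_pos _))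
    simpa only [iteratedDerivWithin_zero] using this
  calc (iteratedDerivWithin (m + 1) u (Icc (0:ℝ) 1) 1) ^ 2
      ≤ (iteratedDerivWithin (m + 1) u (Icc (0:ℝ) 1) 1) ^ 2 * (m.factorial : ℝ) ^ 2 :=
        le_mul_of_one_le_right (sq_nonneg _) hfac
    _ = (∫ x in (0:ℝ)..1, u x * ψ.eval x) ^ 2 := by rw [← mul_pow, hrep]
    _ ≤ ((∫ x in (0:ℝ)..1, ψ.eval x ^ 2) + 1) * ∫ x in (0:ℝ)..1, u x ^ 2 :=
        sq_integral_mul_le hu.continuousOn ψ.continuous.continuousOn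
    _ ≤ _ := mul_le_mul_of_nonneg_left hle (by linarith)
end
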